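/- Let λ ∈ ℝ \ {−1, 0, 1} and let T ∈ B(H) be self-adjoint with orthogonal decomposition H = ker T ⊕ ker(T − I) ⊕ ker(T − λI) ⊕ ker(T − (1+λ)I) ⊕ H₀, where H₀ is the orthogonal complement of the sum of the four kernels (H₀ reduces T). Suppose H₀ = K ⊕ K and T restricted to H₀ equals (B ⊕ (−B)) + ((1+λ)/2)·I for a positive operator B on K with (|1−|λ||/2)·I < B < ((1+|λ|)/2)·I. Then the pairs (P, Q) of orthogonal projections on H with T = λP + Q are exactly the pairs P = 0 ⊕ 0 ⊕ I ⊕ I ⊕ P_U and Q = 0 ⊕ I ⊕ 0 ⊕ I ⊕ Q_U (blocks relative to the above decomposition), where U ranges over the unitaries in B(K) commuting with B; in particular such a pair exists. -/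

import Mathlib

set_option synthInstance.maxHeartbeats 400000
set_option maxHeartbeats 1000000

noncomputable section

/-- `P` is an orthogonal projection: self-adjoint and idempotent. -/
def IsOrthoProj {H : Type*} [NormedAddCommGroup H] [InnerProductSpace ℂ H] [CompleteSpace H]
    (P : H →L[ℂ] H) : Prop :=
  IsSelfAdjoint P ∧ P * P = P

/-- Strict operator inequality `A < B`: `B − A` is positive and injective. -/
def OpLt {H : Type*} [NormedAddCommGroup H] [InnerProductSpace ℂ H] [CompleteSpace H]
    (A B : H →L[ℂ] H) : Prop :=
  (B - A).IsPositive ∧ Function.Injective (B - A)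

/-- The block operator `[[A, B], [C, D]]` on the Hilbert space direct sum `K ⊕₂ K`. -/
def blk {K : Type*} [NormedAddCommGroup K] [InnerProductSpace ℂ K]
    (A B C D : K →L[ℂ] K) : WithLp 2 (K × K) →L[ℂ] WithLp 2 (K × K) :=
  ((WithLp.prodContinuousLinearEquiv 2 ℂ K K).symm : K × K →L[ℂ] WithLp 2 (K × K)) ∘L
    ((A.coprod B).prod (C.coprod D)) ∘L
    ((WithLp.prodContinuousLinearEquiv 2 ℂ K K) : WithLp 2 (K × K) →L[ℂ] K × K)

/-- Block-diagonal operator `A ⊕ C` on the Hilbert space direct sum `E ⊕₂ F`. -/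
def dsum {E F : Type*} [NormedAddCommGroup E] [InnerProductSpace ℂ E]
    [NormedAddCommGroup F] [InnerProductSpace ℂ F]
    (A : E →L[ℂ] E) (C : F →L[ℂ] F) : WithLp 2 (E × F) →L[ℂ] WithLp 2 (E × F) :=
  ((WithLp.prodContinuousLinearEquiv 2 ℂ E F).symm : E × F →L[ℂ] WithLp 2 (E × F)) ∘L
    (A.prodMap C) ∘L
    ((WithLp.prodContinuousLinearEquiv 2 ℂ E F) : WithLp 2 (E × F) →L[ℂ] E × F)

variable {K : Type*} [NormedAddCommGroup K] [InnerProductSpace ℂ K] [CompleteSpace K]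

/-- `c = (1+λ)/2`. -/
def cc (lam : ℝ) : ℂ := (((1 + lam) / 2 : ℝ) : ℂ)

/-- `d = (1−λ)/2`. -/
def dd (lam : ℝ) : ℂ := (((1 - lam) / 2 : ℝ) : ℂ)

/-- `P₁₂ = B⁻¹ (−(B² − c²I)(B² − d²I))^{1/2}` (positive square root). -/
def P12 (lam : ℝ) (B : K →L[ℂ] K) : K →L[ℂ] K :=
  Ring.inverse B * CFC.sqrt (-((B ^ 2 - cc lam ^ 2 • 1) * (B ^ 2 - dd lam ^ 2 • 1)))

/-- The projection `P_U = (1/(2λ))·[[B⁻¹(B+cI)(B−dI), P₁₂U], [U*P₁₂, −B⁻¹(B−cI)(B+dI)]]`. -/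
def PU (lam : ℝ) (B U : K →L[ℂ] K) : WithLp 2 (K × K) →L[ℂ] WithLp 2 (K × K) :=
  (((2 * lam)⁻¹ : ℝ) : ℂ) •
    blk (Ring.inverse B * (B + cc lam • 1) * (B - dd lam • 1)) (P12 lam B * U)
      (star U * P12 lam B) (-(Ring.inverse B * (B - cc lam • 1) * (B + dd lam • 1)))

/-- The projection `Q_U = (1/2)·[[B⁻¹(B+cI)(B+dI), −P₁₂U], [−U*P₁₂, −B⁻¹(B−cI)(B−dI)]]`. -/
def QU (lam : ℝ) (B U : K →L[ℂ] K) : WithLp 2 (K × K) →L[ℂ] WithLp 2 (K × K) :=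
  (((2 : ℝ)⁻¹ : ℝ) : ℂ) •
    blk (Ring.inverse B * (B + cc lam • 1) * (B + dd lam • 1)) (-(P12 lam B * U))
      (-(star U * P12 lam B)) (-(Ring.inverse B * (B - cc lam • 1) * (B - dd lam • 1)))


section DirectSum

variable {E F : Type*} [NormedAddCommGroup E] [InnerProductSpace ℂ E]
  [NormedAddCommGroup F] [InnerProductSpace ℂ F]

lemma dsum_apply (A : E →L[ℂ] E) (C : F →L[ℂ] F) (x : WithLp 2 (E × F)) :
    dsum A C x = WithLp.toLp 2 (A x.fst, C x.snd) := rfl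

lemma dsum_inj {A A' : E →L[ℂ] E} {C C' : F →L[ℂ] F} :
    dsum A C = dsum A' C' ↔ A = A' ∧ C = C' := by
  refine ⟨fun h => ⟨?_, ?_⟩, by rintro ⟨rfl, rfl⟩; rfl⟩
  · ext x
    have := congrArg WithLp.fst (DFunLike.congr_fun h (WithLp.toLp 2 (x, 0)))
    simpa [dsum_apply] using this
  · ext x
    have := congrArg WithLp.snd (DFunLike.congr_fun h (WithLp.toLp 2 (0, x)))
    simpa [dsum_apply] using this

lemma dsum_mul (A A' : E →L[ℂ] E) (C C' : F →L[ℂ] F) :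
    dsum A C * dsum A' C' = dsum (A * A') (C * C') := rfl

lemma dsum_add (A A' : E →L[ℂ] E) (C C' : F →L[ℂ] F) :
    dsum A C + dsum A' C' = dsum (A + A') (C + C') := rfl

lemma smul_dsum (t : ℂ) (A : E →L[ℂ] E) (C : F →L[ℂ] F) :
    t • dsum A C = dsum (t • A) (t • C) := rfl

variable [CompleteSpace E] [CompleteSpace F]

lemma star_dsum (A : E →L[ℂ] E) (C : F →L[ℂ] F) :
    star (dsum A C) = dsum (star A) (star C) := by
  symm
  rw [(dsum A C).star_eq_adjoint, ContinuousLinearMap.eq_adjoint_iff]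
  intro x y
  simp [dsum_apply, WithLp.prod_inner_apply, ContinuousLinearMap.star_eq_adjoint,
    ContinuousLinearMap.adjoint_inner_left]

lemma isOrthoProj_dsum_iff {A : E →L[ℂ] E} {C : F →L[ℂ] F} :
    IsOrthoProj (dsum A C) ↔ IsOrthoProj A ∧ IsOrthoProj C := by
  simp only [IsOrthoProj, IsSelfAdjoint, star_dsum, dsum_mul, dsum_inj]
  tauto

lemma isOrthoProj_smul_one {p : ℝ} (hp : p * p = p) :
    IsOrthoProj ((p : ℂ) • (1 : E →L[ℂ] E)) := by
  refine ⟨by simp [IsSelfAdjoint], ?_⟩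
  rw [smul_mul_smul_comm, one_mul]
  norm_cast
  rw [hp]

/-- A self-adjoint operator acting on the first summand as a scalar is block diagonal. -/
lemma exists_eq_dsum_of_isSelfAdjoint {P : WithLp 2 (E × F) →L[ℂ] WithLp 2 (E × F)}
    (hP : IsSelfAdjoint P) (p : ℂ)
    (h : ∀ e : E, P (WithLp.toLp 2 (e, 0)) = p • WithLp.toLp 2 (e, 0)) :
    ∃ C : F →L[ℂ] F, P = dsum (p • 1) C := by
  let ι : F →L[ℂ] WithLp 2 (E × F) :=
    ((WithLp.prodContinuousLinearEquiv 2 ℂ E F).symm : E × F →L[ℂ] WithLp 2 (E × F)) ∘L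
      ContinuousLinearMap.inr ℂ E F
  let π : WithLp 2 (E × F) →L[ℂ] F := ContinuousLinearMap.snd ℂ E F ∘L
    ((WithLp.prodContinuousLinearEquiv 2 ℂ E F) : WithLp 2 (E × F) →L[ℂ] E × F)
  have hι (f : F) : ι f = WithLp.toLp 2 (0, f) := rfl
  have hπ (x : WithLp 2 (E × F)) : π x = x.snd := rfl
  have hfst (f : F) : (P (ι f)).fst = 0 := by
    refine ext_inner_left ℂ fun e => ?_
    have h1 : inner ℂ (P (WithLp.toLp 2 (e, 0))) (ι f) =
        inner ℂ (WithLp.toLp 2 (e, (0 : F))) (P (ι f)) := hP.isSymmetric _ _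
    rw [h] at h1
    simpa [hι, WithLp.prod_inner_apply] using h1.symm
  refine ⟨π ∘L P ∘L ι, ?_⟩
  ext1 x
  have hx : x = WithLp.toLp 2 (x.fst, 0) + ι x.snd := by
    refine WithLp.ofLp_injective 2 (Prod.ext ?_ ?_) <;> simp [hι]
  have hPx : P x = p • WithLp.toLp 2 (x.fst, (0 : F)) + P (ι x.snd) := by
    conv_lhs => rw [hx, map_add, h]
  rw [hPx, dsum_apply]
  refine WithLp.ofLp_injective 2 (Prod.ext ?_ ?_)
  · simpa using hfst x.snd
  · simp [hπ]

end DirectSum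

section Peel

variable {H : Type*} [NormedAddCommGroup H] [InnerProductSpace ℂ H] [CompleteSpace H]

/-- For an orthogonal projection `P` and `p ∈ {0, 1}`, the operator `P - p` is self-adjoint with
square `(1 - 2p) (P - p)`. -/
lemma IsOrthoProj.norm_sub_smul_sq {P : H →L[ℂ] H} (hP : IsOrthoProj P) {p : ℝ}
    (hp : p * p = p) (x : H) :
    inner ℂ (P x - (p : ℂ) • x) (P x - (p : ℂ) • x) =
      ((1 - 2 * p : ℝ) : ℂ) * inner ℂ (P x - (p : ℂ) • x) x := by
  have h1 : inner ℂ (P x) (P x) = inner ℂ (P x) x := by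
    have h := hP.1.isSymmetric (P x) x
    rw [ContinuousLinearMap.coe_coe, ← mul_apply_eq_comp, hP.2] at h
    exact h.symm
  have h2 : inner ℂ x (P x) = inner ℂ (P x) x := (hP.1.isSymmetric x x).symm
  have hp' : (p : ℂ) * p = p := by exact_mod_cast hp
  simp only [inner_sub_left, inner_sub_right, inner_smul_left, inner_smul_right, h1, h2,
    Complex.conj_ofReal]
  push_cast
  linear_combination (-inner ℂ x x) * hp'

/-- An eigenvector of `l P + Q` for the eigenvalue `l p + q`, with `p, q ∈ {0, 1}`, is a common
eigenvector of the orthogonal projections `P` and `Q`. -/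
lemma IsOrthoProj.apply_eq_of_pencil {P Q : H →L[ℂ] H} (hP : IsOrthoProj P) (hQ : IsOrthoProj Q)
    {l p q : ℝ} (hp : p * p = p) (hq : q * q = q) (hl : l ≠ 0)
    (hne : l + (1 - 2 * p) * (1 - 2 * q) ≠ 0) {x : H}
    (hx : (l : ℂ) • P x + Q x = ((l * p + q : ℝ) : ℂ) • x) :
    P x = (p : ℂ) • x ∧ Q x = (q : ℂ) • x := by
  have key : Q x - (q : ℂ) • x = -(l : ℂ) • (P x - (p : ℂ) • x) := by
    have : Q x = ((l * p + q : ℝ) : ℂ) • x - (l : ℂ) • P x := by rw [← hx]; abel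
    rw [this]
    push_cast
    module
  have hN := hP.norm_sub_smul_sq hp x
  have hM := hQ.norm_sub_smul_sq hq x
  rw [key] at hM
  simp only [inner_smul_left, inner_smul_right, map_neg, Complex.conj_ofReal] at hM
  have hp' : (p : ℂ) * p = p := by exact_mod_cast hp
  have hq' : (q : ℂ) * q = q := by exact_mod_cast hq
  have hne' : (l : ℂ) + (1 - 2 * p) * (1 - 2 * q) ≠ 0 := by exact_mod_cast hne
  have hl' : (l : ℂ) ≠ 0 := by exact_mod_cast hl
  have hz : (l : ℂ) * (l + (1 - 2 * p) * (1 - 2 * q)) *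
      inner ℂ (P x - (p : ℂ) • x) (P x - (p : ℂ) • x) = 0 := by
    push_cast at hM hN
    have hp2 : (1 - 2 * (p : ℂ)) * (1 - 2 * p) = 1 := by linear_combination 4 * hp'
    linear_combination hM + (l : ℂ) * (1 - 2 * p) * (1 - 2 * q) * hN +
      (l : ℂ) * (1 - 2 * q) * inner ℂ (P x - (p : ℂ) • x) x * hp2
  have h0 : P x - (p : ℂ) • x = 0 := by
    simpa [hl', hne'] using hz
  refine ⟨sub_eq_zero.mp h0, sub_eq_zero.mp ?_⟩
  rw [key, h0, smul_zero]

variable {E F : Type*} [NormedAddCommGroup E] [InnerProductSpace ℂ E] [CompleteSpace E]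
  [NormedAddCommGroup F] [InnerProductSpace ℂ F] [CompleteSpace F]

/-- Solutions of `T = l P + Q` split off every eigenspace of `T` for an eigenvalue `l p + q` with
`p, q ∈ {0, 1}`. -/
lemma pencil_dsum_iff {l : ℝ} (p q : ℝ) (hp : p * p = p) (hq : q * q = q) (hl : l ≠ 0)
    (hne : l + (1 - 2 * p) * (1 - 2 * q) ≠ 0) {A P₀ Q₀ : E →L[ℂ] E}
    (hA : A = ((l * p + q : ℝ) : ℂ) • 1) (hP₀ : P₀ = (p : ℂ) • 1) (hQ₀ : Q₀ = (q : ℂ) • 1)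
    {T : F →L[ℂ] F} {P Q : WithLp 2 (E × F) →L[ℂ] WithLp 2 (E × F)} :
    (IsOrthoProj P ∧ IsOrthoProj Q ∧ dsum A T = (l : ℂ) • P + Q) ↔
      ∃ P' Q' : F →L[ℂ] F, P = dsum P₀ P' ∧ Q = dsum Q₀ Q' ∧
        (IsOrthoProj P' ∧ IsOrthoProj Q' ∧ T = (l : ℂ) • P' + Q') := by
  subst hP₀ hQ₀
  constructor
  · rintro ⟨hP, hQ, h⟩
    have hev (e : E) := hP.apply_eq_of_pencil hQ hp hq hl hne (x := WithLp.toLp 2 (e, (0 : F))) (by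
      have := DFunLike.congr_fun h (WithLp.toLp 2 (e, (0 : F)))
      simp only [add_apply, smul_apply] at this
      rw [← this, dsum_apply, hA]
      refine WithLp.ofLp_injective 2 (Prod.ext ?_ ?_) <;> simp)
    obtain ⟨P', rfl⟩ := exists_eq_dsum_of_isSelfAdjoint hP.1 p fun e => (hev e).1
    obtain ⟨Q', rfl⟩ := exists_eq_dsum_of_isSelfAdjoint hQ.1 q fun e => (hev e).2
    rw [smul_dsum, dsum_add, dsum_inj] at h
    exact ⟨P', Q', rfl, rfl, (isOrthoProj_dsum_iff.mp hP).2, (isOrthoProj_dsum_iff.mp hQ).2, h.2⟩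
  · rintro ⟨P', Q', rfl, rfl, hP, hQ, rfl⟩
    refine ⟨isOrthoProj_dsum_iff.mpr ⟨isOrthoProj_smul_one hp, hP⟩,
      isOrthoProj_dsum_iff.mpr ⟨isOrthoProj_smul_one hq, hQ⟩, ?_⟩
    rw [smul_dsum, dsum_add, hA, smul_smul, ← add_smul]
    push_cast
    rfl

end Peel

section Block

variable {F : Type*} [NormedAddCommGroup F] [InnerProductSpace ℂ F]
  {A₁₁ A₁₂ A₂₁ A₂₂ B₁₁ B₁₂ B₂₁ B₂₂ : F →L[ℂ] F}

lemma blk_apply (A B C D : F →L[ℂ] F) (x : WithLp 2 (F × F)) :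
    blk A B C D x = WithLp.toLp 2 (A x.fst + B x.snd, C x.fst + D x.snd) := rfl

lemma blk_inj : blk A₁₁ A₁₂ A₂₁ A₂₂ = blk B₁₁ B₁₂ B₂₁ B₂₂ ↔
    A₁₁ = B₁₁ ∧ A₁₂ = B₁₂ ∧ A₂₁ = B₂₁ ∧ A₂₂ = B₂₂ := by
  refine ⟨fun h => ⟨?_, ?_, ?_, ?_⟩, by rintro ⟨rfl, rfl, rfl, rfl⟩; rfl⟩ <;> ext x
  · simpa [blk_apply] using congrArg WithLp.fst (DFunLike.congr_fun h (WithLp.toLp 2 (x, 0)))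
  · simpa [blk_apply] using congrArg WithLp.fst (DFunLike.congr_fun h (WithLp.toLp 2 (0, x)))
  · simpa [blk_apply] using congrArg WithLp.snd (DFunLike.congr_fun h (WithLp.toLp 2 (x, 0)))
  · simpa [blk_apply] using congrArg WithLp.snd (DFunLike.congr_fun h (WithLp.toLp 2 (0, x)))

lemma exists_eq_blk (P : WithLp 2 (F × F) →L[ℂ] WithLp 2 (F × F)) :
    ∃ A B C D : F →L[ℂ] F, P = blk A B C D := by
  let e := WithLp.prodContinuousLinearEquiv 2 ℂ F F
  let P' : F × F →L[ℂ] F × F := (e : WithLp 2 (F × F) →L[ℂ] F × F) ∘L P ∘L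
    (e.symm : F × F →L[ℂ] WithLp 2 (F × F))
  refine ⟨ContinuousLinearMap.fst ℂ F F ∘L P' ∘L ContinuousLinearMap.inl ℂ F F,
    ContinuousLinearMap.fst ℂ F F ∘L P' ∘L ContinuousLinearMap.inr ℂ F F,
    ContinuousLinearMap.snd ℂ F F ∘L P' ∘L ContinuousLinearMap.inl ℂ F F,
    ContinuousLinearMap.snd ℂ F F ∘L P' ∘L ContinuousLinearMap.inr ℂ F F, ?_⟩
  ext1 x
  have hx : x = e.symm (x.fst, 0) + e.symm (0, x.snd) := by
    refine WithLp.ofLp_injective 2 (Prod.ext ?_ ?_) <;> simp [e]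
  conv_lhs => rw [hx, map_add]
  rfl

lemma blk_mul : blk A₁₁ A₁₂ A₂₁ A₂₂ * blk B₁₁ B₁₂ B₂₁ B₂₂ =
    blk (A₁₁ * B₁₁ + A₁₂ * B₂₁) (A₁₁ * B₁₂ + A₁₂ * B₂₂)
      (A₂₁ * B₁₁ + A₂₂ * B₂₁) (A₂₁ * B₁₂ + A₂₂ * B₂₂) := by
  ext1 x
  refine WithLp.ofLp_injective 2 (Prod.ext ?_ ?_) <;> simp [blk_apply] <;> abel

lemma blk_add : blk A₁₁ A₁₂ A₂₁ A₂₂ + blk B₁₁ B₁₂ B₂₁ B₂₂ =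
    blk (A₁₁ + B₁₁) (A₁₂ + B₁₂) (A₂₁ + B₂₁) (A₂₂ + B₂₂) := by
  ext1 x
  refine WithLp.ofLp_injective 2 (Prod.ext ?_ ?_) <;> simp [blk_apply] <;> abel

lemma smul_blk (t : ℂ) :
    t • blk A₁₁ A₁₂ A₂₁ A₂₂ = blk (t • A₁₁) (t • A₁₂) (t • A₂₁) (t • A₂₂) := by
  ext1 x
  refine WithLp.ofLp_injective 2 (Prod.ext ?_ ?_) <;> simp [blk_apply]

lemma blk_one : blk (1 : F →L[ℂ] F) 0 0 1 = 1 := by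
  ext1 x
  refine WithLp.ofLp_injective 2 (Prod.ext ?_ ?_) <;> simp [blk_apply]

lemma star_blk [CompleteSpace F] : star (blk A₁₁ A₁₂ A₂₁ A₂₂) =
    blk (star A₁₁) (star A₂₁) (star A₁₂) (star A₂₂) := by
  symm
  rw [(blk A₁₁ A₁₂ A₂₁ A₂₂).star_eq_adjoint, ContinuousLinearMap.eq_adjoint_iff]
  intro x y
  simp [blk_apply, WithLp.prod_inner_apply, ContinuousLinearMap.star_eq_adjoint,
    ContinuousLinearMap.adjoint_inner_left, inner_add_left, inner_add_right]
  ring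

end Block

section Polar

lemma denseRange_of_isSelfAdjoint_of_injective {w : K →L[ℂ] K} (hw : IsSelfAdjoint w)
    (hinj : Function.Injective w) : DenseRange w := by
  have h : (LinearMap.range (w : K →ₗ[ℂ] K)).topologicalClosure = ⊤ := by
    rw [Submodule.topologicalClosure_eq_top_iff, ContinuousLinearMap.orthogonal_range,
      ← ContinuousLinearMap.star_eq_adjoint, hw.star_eq]
    exact LinearMap.ker_eq_bot.mpr hinj
  exact Submodule.dense_iff_topologicalClosure_eq_top.mpr h

/-- Polar decomposition `y = w U` of a normal operator with given injective self-adjoint `w` such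
that `w² = y* y`. -/
lemma exists_unitary_of_star_mul_self_eq {w y : K →L[ℂ] K} (hw : IsSelfAdjoint w)
    (hinj : Function.Injective w) (hwy : Commute w y) (h₁ : star y * y = w * w)
    (h₂ : y * star y = w * w) :
    ∃ U ∈ unitary (K →L[ℂ] K), y = w * U ∧
      ∀ X : K →L[ℂ] K, Commute X w → Commute X y → Commute U X := by
  have hdense := denseRange_of_isSelfAdjoint_of_injective hw hinj
  have hL {X Y : K →L[ℂ] K} (h : w * X = w * Y) : X = Y := by
    ext x
    exact hinj (DFunLike.congr_fun h x)
  have hR {X Y : K →L[ℂ] K} (h : X * w = Y * w) : X = Y := by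
    refine DFunLike.coe_injective (hdense.equalizer X.continuous Y.continuous ?_)
    funext x
    exact DFunLike.congr_fun h x
  have hnorm (x : K) : ‖y x‖ = ‖w x‖ := by
    have hy := y.apply_norm_sq_eq_inner_adjoint_left x
    have hw' := w.apply_norm_sq_eq_inner_adjoint_left x
    rw [← ContinuousLinearMap.star_eq_adjoint] at hy hw'
    rw [hw.star_eq, ← ContinuousLinearMap.mul_def, ← h₁] at hw'
    rw [← ContinuousLinearMap.mul_def, ← hw'] at hy
    exact (sq_eq_sq₀ (norm_nonneg _) (norm_nonneg _)).mp hy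
  obtain ⟨U, hU⟩ : ∃ U : K →L[ℂ] K, U * w = y := by
    refine ⟨LinearMap.extendOfNorm (y : K →ₗ[ℂ] K) (w : K →ₗ[ℂ] K), ?_⟩
    ext x
    exact LinearMap.extendOfNorm_eq (f := (y : K →ₗ[ℂ] K)) (e := (w : K →ₗ[ℂ] K)) hdense
      ⟨1, fun x => by simp [hnorm]⟩ x
  have hU' : w * U = y := hR (by rw [mul_assoc, hU, hwy.eq])
  have hsU : star U * w = star y := by rw [← hU', star_mul, hw.star_eq]
  have hsU' : w * star U = star y := by rw [← hU, star_mul, hw.star_eq]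
  refine ⟨U, Unitary.mem_iff.mpr ⟨?_, ?_⟩, hU'.symm, fun X hXw hXy => ?_⟩
  · refine hL (hR ?_)
    rw [← mul_assoc, hsU', mul_assoc, hU, h₁, mul_one]
  · refine hL (hR ?_)
    rw [← mul_assoc, hU', mul_assoc, hsU, h₂, mul_one]
  · refine hL ?_
    rw [← mul_assoc, hU', ← mul_assoc, ← hXw.eq, mul_assoc, hU', hXy.eq]

end Polar

section Positive

lemma Commute.cfcSqrt_right {X A : K →L[ℂ] K} (h : Commute X A) : Commute X (CFC.sqrt A) :=
  (Commute.cfcₙ_nnreal h.symm _).symm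

lemma isUnit_add_smul_one {A : K →L[ℂ] K} (hA : 0 ≤ A) {t : ℝ} (ht : 0 < t) :
    IsUnit (A + (t : ℂ) • 1) := by
  have ht1 : (0 : K →L[ℂ] K) ≤ (t : ℂ) • 1 := by
    rw [Complex.coe_smul]
    exact smul_nonneg ht.le zero_le_one
  refine CStarAlgebra.isUnit_of_le ((t : ℂ) • (1 : K →L[ℂ] K)) (le_add_of_nonneg_left hA)
    ⟨ht1, ?_⟩
  have ht0 : (t : ℂ) ≠ 0 := by exact_mod_cast ht.ne'
  exact (Units.mk0 (t : ℂ) ht0 • (1 : (K →L[ℂ] K)ˣ)).isUnit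

lemma eq_zero_of_anticommute {B z : K →L[ℂ] K} (hB : 0 ≤ B) (hu : IsUnit B)
    (h : B * z + z * B = 0) : z = 0 := by
  have hz : B * z = -(z * B) := eq_neg_of_add_eq_zero_left h
  have h2 : Commute z (B * B) := by
    rw [Commute, SemiconjBy, mul_assoc, hz, mul_neg, ← mul_assoc B z, hz, neg_mul, neg_neg,
      mul_assoc]
  have h1 : z * B = B * z := by
    have := h2.cfcSqrt_right
    rwa [CFC.sqrt_mul_self B hB] at this
  rw [h1, ← two_smul ℂ, smul_eq_zero] at h
  exact hu.mul_right_eq_zero.mp (h.resolve_left two_ne_zero)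

end Positive

section Pencil

lemma cc_add_dd (lam : ℝ) : cc lam + dd lam = 1 := by
  simp only [cc, dd]; push_cast; ring

lemma cc_sub_dd (lam : ℝ) : cc lam - dd lam = lam := by
  simp only [cc, dd]; push_cast; ring

lemma ringInverse_mul_add_smul_mul_add_smul {A : Type*} [Ring A] [Algebra ℂ A] {B : A}
    (hu : IsUnit B) (s t : ℂ) :
    Ring.inverse B * (B + s • 1) * (B + t • 1) =
      B + (s + t) • 1 + (s * t) • Ring.inverse B := by
  have h := Ring.inverse_mul_cancel B hu
  simp only [mul_add, add_mul, mul_smul_comm, smul_mul_assoc, mul_one, one_mul, h]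
  module

/-- The block operator `[[x, w U], [U* w, -x]]`. -/
def blkRefl (x w U : K →L[ℂ] K) : WithLp 2 (K × K) →L[ℂ] WithLp 2 (K × K) :=
  blk x (w * U) (star U * w) (-x)

lemma PU_eq {lam : ℝ} (hl : lam ≠ 0) {B : K →L[ℂ] K} (hu : IsUnit B) (U : K →L[ℂ] K) :
    PU lam B U = (2⁻¹ : ℂ) • (1 + (lam : ℂ)⁻¹ •
      blkRefl (B - (cc lam * dd lam) • Ring.inverse B) (P12 lam B) U) := by
  have hl' : (lam : ℂ) ≠ 0 := by exact_mod_cast hl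
  have hd := cc_sub_dd lam
  simp only [PU, blkRefl, sub_eq_add_neg, ← neg_smul, ringInverse_mul_add_smul_mul_add_smul hu]
  rw [← blk_one, smul_blk, smul_blk, blk_add, smul_blk, blk_inj]
  push_cast
  rw [← sub_eq_add_neg, hd, neg_add_eq_sub, ← neg_sub (cc lam), hd]
  refine ⟨?_, ?_, ?_, ?_⟩ <;> match_scalars <;> field_simp

lemma QU_eq {lam : ℝ} {B : K →L[ℂ] K} (hu : IsUnit B) (U : K →L[ℂ] K) :
    QU lam B U = (2⁻¹ : ℂ) • (1 +
      blkRefl (B + (cc lam * dd lam) • Ring.inverse B) (P12 lam B) (-U)) := by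
  have hd := cc_add_dd lam
  simp only [QU, blkRefl, sub_eq_add_neg, ← neg_smul, ringInverse_mul_add_smul_mul_add_smul hu]
  rw [← blk_one, blk_add, smul_blk, smul_blk, blk_inj]
  push_cast
  rw [← neg_add, hd]
  simp only [star_neg, neg_mul, mul_neg]
  refine ⟨?_, ?_, ?_, ?_⟩ <;> match_scalars <;> field_simp

lemma star_blkRefl {x w : K →L[ℂ] K} (hx : IsSelfAdjoint x) (hw : IsSelfAdjoint w)
    (U : K →L[ℂ] K) : star (blkRefl x w U) = blkRefl x w U := by
  simp only [blkRefl, star_blk, star_mul, star_neg, star_star, hx.star_eq, hw.star_eq]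

lemma blkRefl_mul_self {x w U : K →L[ℂ] K} (hx : IsSelfAdjoint x) (hxw : Commute x w)
    (hU : U ∈ unitary (K →L[ℂ] K))
    (hUx : Commute U x) (hUw : Commute U w) (hw : IsSelfAdjoint w) {t : ℂ}
    (h : x * x + w * w = t • 1) : blkRefl x w U * blkRefl x w U = t • 1 := by
  have hUU := Unitary.star_mul_self_of_mem hU
  have hUU' := Unitary.mul_star_self_of_mem hU
  have hsUw : star U * w = w * star U := by
    simpa [hw.star_eq] using (congrArg star hUw.eq).symm
  have hsUx : star U * x = x * star U := by
    simpa [hx.star_eq] using (congrArg star hUx.eq).symm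
  have e₁ : w * U * (star U * w) = w * w := by
    rw [mul_assoc, ← mul_assoc U, hUU', one_mul]
  have e₂ : x * (w * U) = w * U * x := by
    rw [mul_assoc, hUx.eq, ← mul_assoc, ← mul_assoc, hxw.eq]
  have e₃ : star U * w * (w * U) = w * w := by
    rw [← hUw.eq, hsUw, mul_assoc, ← mul_assoc (star U), hUU, one_mul]
  have e₄ : star U * w * x = x * (star U * w) := by
    rw [mul_assoc, ← hxw.eq, ← mul_assoc, hsUx, mul_assoc]
  rw [blkRefl, blk_mul, ← blk_one, smul_blk, blk_inj]
  refine ⟨?_, ?_, ?_, ?_⟩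
  · rw [e₁, h]
  · rw [e₂, mul_neg, add_neg_cancel, smul_zero]
  · rw [e₄, neg_mul, add_neg_cancel, smul_zero]
  · rw [e₃, neg_mul_neg, add_comm, h]

lemma isOrthoProj_of_mul_self_eq {H : Type*} [NormedAddCommGroup H] [InnerProductSpace ℂ H]
    [CompleteSpace H] {J : H →L[ℂ] H} (hJ : star J = J) {s : ℝ} (hs : s ≠ 0)
    (h : J * J = ((s : ℂ) * s) • 1) : IsOrthoProj ((2⁻¹ : ℂ) • (1 + (s : ℂ)⁻¹ • J)) := by
  have hs' : (s : ℂ) ≠ 0 := by exact_mod_cast hs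
  refine ⟨by simp [IsSelfAdjoint, hJ], ?_⟩
  simp only [mul_add, add_mul, mul_smul_comm, smul_mul_assoc, mul_one, one_mul, h, smul_smul,
    smul_add]
  match_scalars <;> field_simp <;> ring

lemma IsOrthoProj.two_smul_sub_one_mul_self {H : Type*} [NormedAddCommGroup H]
    [InnerProductSpace ℂ H] [CompleteSpace H] {P : H →L[ℂ] H} (hP : IsOrthoProj P) :
    ((2 : ℂ) • P - 1) * ((2 : ℂ) • P - 1) = 1 := by
  simp only [mul_sub, sub_mul, mul_smul_comm, smul_mul_assoc, mul_one, one_mul, hP.2]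
  module

lemma IsOrthoProj.star_smul_two_smul_sub_one {H : Type*} [NormedAddCommGroup H]
    [InnerProductSpace ℂ H] [CompleteSpace H] {P : H →L[ℂ] H} (hP : IsOrthoProj P) (l : ℝ) :
    star ((l : ℂ) • ((2 : ℂ) • P - 1)) = (l : ℂ) • ((2 : ℂ) • P - 1) := by
  simp [hP.1.star_eq]

/-- The facts about `B⁻¹` and `P₁₂` on which the classification rests. -/
structure PencilData (lam : ℝ) (B : K →L[ℂ] K) : Prop where
  nonneg : 0 ≤ B
  isUnit : IsUnit B
  isSelfAdjoint_P12 : IsSelfAdjoint (P12 lam B)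
  injective_P12 : Function.Injective (P12 lam B)
  commute_P12 : ∀ X : K →L[ℂ] K, Commute X B → Commute X (P12 lam B)
  P12_mul_self : P12 lam B * P12 lam B = ((lam : ℂ) * lam) • 1 -
    (B - (cc lam * dd lam) • Ring.inverse B) * (B - (cc lam * dd lam) • Ring.inverse B)

lemma Commute.ringInverse_right {M : Type*} [MonoidWithZero M] {X B : M} (hu : IsUnit B)
    (h : Commute X B) :
    Commute X (Ring.inverse B) := by
  obtain ⟨u, rfl⟩ := hu
  rw [Ring.inverse_unit]
  exact h.units_inv_right

lemma isUnit_of_opLt {m : ℝ} (hm : 0 < m) {B : K →L[ℂ] K}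
    (h : OpLt ((m : ℂ) • (1 : K →L[ℂ] K)) B) : IsUnit B := by
  have := isUnit_add_smul_one ((ContinuousLinearMap.nonneg_iff_isPositive _).mpr h.1) hm
  rwa [sub_add_cancel] at this

lemma pencilData {lam : ℝ} (hlam : lam ≠ -1 ∧ lam ≠ 0 ∧ lam ≠ 1)
    {B : K →L[ℂ] K} (hBpos : B.IsPositive)
    (hB₁ : OpLt (((abs (1 - |lam|) / 2 : ℝ) : ℂ) • (1 : K →L[ℂ] K)) B)
    (hB₂ : OpLt B ((((1 + |lam|) / 2 : ℝ) : ℂ) • (1 : K →L[ℂ] K))) : PencilData lam B := by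
  have hB : 0 ≤ B := (ContinuousLinearMap.nonneg_iff_isPositive _).mpr hBpos
  have hm : 0 < abs (1 - |lam|) / 2 := by
    have : 1 - |lam| ≠ 0 := by
      intro h
      rcases (abs_eq zero_le_one).mp (sub_eq_zero.mp h).symm with h | h
      exacts [hlam.2.2 h, hlam.1 h]
    positivity
  have hM : 0 < (1 + |lam|) / 2 := by positivity
  have hsum : cc lam ^ 2 + dd lam ^ 2 =
      ((abs (1 - |lam|) / 2 : ℝ) : ℂ) ^ 2 + (((1 + |lam|) / 2 : ℝ) : ℂ) ^ 2 := by
    simp only [cc, dd]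
    norm_cast
    rw [div_pow (abs (1 - |lam|)), sq_abs]
    linear_combination (-1 / 2) * sq_abs lam
  have hprod : cc lam ^ 2 * dd lam ^ 2 =
      ((abs (1 - |lam|) / 2 : ℝ) : ℂ) ^ 2 * (((1 + |lam|) / 2 : ℝ) : ℂ) ^ 2 := by
    simp only [cc, dd]
    norm_cast
    rw [div_pow (abs (1 - |lam|)), sq_abs]
    linear_combination (-(|lam| ^ 2 + lam ^ 2 - 2) / 16) * sq_abs lam
  have hu : IsUnit B := isUnit_of_opLt hm hB₁
  set m : ℝ := abs (1 - |lam|) / 2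
  set M : ℝ := (1 + |lam|) / 2
  set S₂ : K →L[ℂ] K := -((B ^ 2 - cc lam ^ 2 • 1) * (B ^ 2 - dd lam ^ 2 • 1)) with hS₂
  set R := Ring.inverse B
  have hBR : B * R = 1 := Ring.mul_inverse_cancel B hu
  have hRB : R * B = 1 := Ring.inverse_mul_cancel B hu
  have hexp : S₂ = (cc lam ^ 2 + dd lam ^ 2) • (B * B) - B * (B * (B * B)) -
      (cc lam ^ 2 * dd lam ^ 2) • 1 := by
    simp only [hS₂, pow_two B, mul_sub, sub_mul, mul_smul_comm, smul_mul_assoc, mul_one, one_mul,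
      mul_assoc]
    module
  have hfac : S₂ = ((B - (m : ℂ) • 1) * ((M : ℂ) • 1 - B)) *
      ((B + (m : ℂ) • 1) * (B + (M : ℂ) • 1)) := by
    rw [hexp, hsum, hprod]
    simp only [mul_sub, sub_mul, mul_add, add_mul, mul_smul_comm, smul_mul_assoc, mul_one, one_mul,
      smul_smul, mul_assoc, smul_add, smul_sub]
    module
  have hcs (t : ℂ) : Commute B (t • (1 : K →L[ℂ] K)) := (Commute.one_right B).smul_right t
  have h1 : 0 ≤ (B - (m : ℂ) • 1) * ((M : ℂ) • 1 - B) := by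
    refine Commute.mul_nonneg ((ContinuousLinearMap.nonneg_iff_isPositive _).mpr hB₁.1)
      ((ContinuousLinearMap.nonneg_iff_isPositive _).mpr hB₂.1) ?_
    refine Commute.sub_left (Commute.sub_right (hcs _) (Commute.refl B)) ?_
    exact ((Commute.one_left _).smul_left _)
  have hadd {t : ℝ} (ht : 0 < t) : 0 ≤ B + (t : ℂ) • 1 := by
    rw [Complex.coe_smul]
    exact add_nonneg hB (smul_nonneg ht.le zero_le_one)
  have h2 : 0 ≤ (B + (m : ℂ) • 1) * (B + (M : ℂ) • 1) := by
    refine Commute.mul_nonneg (hadd hm) (hadd hM) ?_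
    exact Commute.add_left (Commute.add_right (Commute.refl B) (hcs _))
      ((Commute.one_left _).smul_left _)
  have hcomm {X : K →L[ℂ] K} (hX : Commute X B) : Commute X S₂ := by
    have hX2 (t : ℂ) : Commute X (B ^ 2 - t • 1) :=
      (hX.pow_right 2).sub_right ((Commute.one_right X).smul_right t)
    exact ((hX2 _).mul_right (hX2 _)).neg_right
  have hS₂nonneg : 0 ≤ S₂ := by
    rw [hfac]
    refine Commute.mul_nonneg h1 h2 ?_
    have hX2 (t : ℂ) : Commute B (B + t • 1) := (Commute.refl B).add_right (hcs t)
    have hX3 : Commute B ((B + (m : ℂ) • 1) * (B + (M : ℂ) • 1)) := (hX2 _).mul_right (hX2 _)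
    exact (hX3.sub_left ((Commute.one_left _).smul_left _)).mul_left
      (((Commute.one_left _).smul_left _).sub_left hX3)
  have hinv {A : K →L[ℂ] K} (hA : IsUnit A) : Function.Injective A := by
    intro x y hxy
    have := congrArg (fun v => (Ring.inverse A : K →L[ℂ] K) v) hxy
    simpa only [← mul_apply_eq_comp, Ring.inverse_mul_cancel A hA, one_apply_eq_self]
      using this
  have hS₂inj : Function.Injective S₂ := by
    rw [hfac]
    exact (hB₁.2.comp hB₂.2).comp
      ((hinv (isUnit_add_smul_one hB hm)).comp (hinv (isUnit_add_smul_one hB hM)))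
  set S := CFC.sqrt S₂ with hS
  have hSS : S * S = S₂ := CFC.sqrt_mul_sqrt_self S₂ hS₂nonneg
  have hSinj : Function.Injective S := by
    refine Function.Injective.of_comp (f := S) ?_
    have : Function.Injective (S * S) := hSS ▸ hS₂inj
    exact this
  have hw : P12 lam B = R * S := rfl
  have hcS {X : K →L[ℂ] K} (hX : Commute X B) : Commute X S := (hcomm hX).cfcSqrt_right
  have hBS := hcS (Commute.refl B)
  have hRS : Commute R S := hcS (Commute.ringInverse_right hu (Commute.refl B)).symm
  have hSsa : IsSelfAdjoint S := IsSelfAdjoint.of_nonneg (CFC.sqrt_nonneg S₂)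
  have hRsa : IsSelfAdjoint R := by
    rw [IsSelfAdjoint, ← Ring.inverse_star, hBpos.isSelfAdjoint.star_eq]
  refine ⟨hB, hu, ?_, ?_, fun X hX => ?_, ?_⟩
  · rw [hw, IsSelfAdjoint, star_mul, hSsa.star_eq, hRsa.star_eq, hRS.eq]
  · rw [hw]
    exact (hinv hu.ringInverse).comp hSinj
  · exact (Commute.ringInverse_right hu hX).mul_right (hcS hX)
  · have hRR : R * (R * S₂) = (cc lam ^ 2 + dd lam ^ 2) • 1 - B * B -
        (cc lam ^ 2 * dd lam ^ 2) • (R * R) := by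
      rw [hexp]
      simp only [mul_sub, mul_smul_comm, mul_one, ← mul_assoc R B, hRB, one_mul]
    change P12 lam B * P12 lam B = ((lam : ℂ) * lam) • 1 -
      (B - (cc lam * dd lam) • R) * (B - (cc lam * dd lam) • R)
    rw [hw, mul_assoc, ← mul_assoc S, ← hRS.eq, mul_assoc, hSS, hRR]
    simp only [mul_sub, sub_mul, mul_smul_comm, smul_mul_assoc, hRB, hBR, smul_smul, smul_sub,
      ← cc_sub_dd lam]
    module

end Pencil

section Classification

variable {lam : ℝ} {B : K →L[ℂ] K}

namespace PencilData

lemma isSelfAdjoint (D : PencilData lam B) : IsSelfAdjoint B := .of_nonneg D.nonneg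

lemma isSelfAdjoint_ringInverse (D : PencilData lam B) : IsSelfAdjoint (Ring.inverse B) := by
  rw [IsSelfAdjoint, ← Ring.inverse_star, D.isSelfAdjoint.star_eq]

lemma mul_ringInverse (D : PencilData lam B) : B * Ring.inverse B = 1 :=
  Ring.mul_inverse_cancel B D.isUnit

lemma ringInverse_mul (D : PencilData lam B) : Ring.inverse B * B = 1 :=
  Ring.inverse_mul_cancel B D.isUnit

lemma isSelfAdjoint_cc_mul_dd_smul (D : PencilData lam B) :
    IsSelfAdjoint ((cc lam * dd lam) • Ring.inverse B) := by
  rw [IsSelfAdjoint, star_smul, D.isSelfAdjoint_ringInverse.star_eq]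
  simp [cc, dd]

lemma commute_ringInverse (D : PencilData lam B) {X : K →L[ℂ] K} (hX : Commute X B) (t : ℂ) :
    Commute X (t • Ring.inverse B) :=
  (Commute.ringInverse_right D.isUnit hX).smul_right t

lemma isOrthoProj_PU (D : PencilData lam B) (hl : lam ≠ 0) {U : K →L[ℂ] K}
    (hU : U ∈ unitary (K →L[ℂ] K)) (hUB : Commute U B) : IsOrthoProj (PU lam B U) := by
  have hx := D.isSelfAdjoint.sub D.isSelfAdjoint_cc_mul_dd_smul
  have hc {X : K →L[ℂ] K} (hX : Commute X B) := hX.sub_right (D.commute_ringInverse hX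
    (cc lam * dd lam))
  rw [PU_eq hl D.isUnit]
  refine isOrthoProj_of_mul_self_eq (star_blkRefl hx D.isSelfAdjoint_P12 U) hl ?_
  refine blkRefl_mul_self hx (D.commute_P12 _ (hc (Commute.refl B)).symm) hU (hc hUB)
    (D.commute_P12 _ hUB) D.isSelfAdjoint_P12 ?_
  rw [D.P12_mul_self]
  abel

lemma isOrthoProj_QU (D : PencilData lam B) {U : K →L[ℂ] K}
    (hU : U ∈ unitary (K →L[ℂ] K)) (hUB : Commute U B) : IsOrthoProj (QU lam B U) := by
  have hx := D.isSelfAdjoint.add D.isSelfAdjoint_cc_mul_dd_smul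
  have hc {X : K →L[ℂ] K} (hX : Commute X B) := hX.add_right (D.commute_ringInverse hX
    (cc lam * dd lam))
  have hU' : -U ∈ unitary (K →L[ℂ] K) := by
    simpa [Unitary.mem_iff] using Unitary.mem_iff.mp hU
  have h : blkRefl (B + (cc lam * dd lam) • Ring.inverse B) (P12 lam B) (-U) *
      blkRefl (B + (cc lam * dd lam) • Ring.inverse B) (P12 lam B) (-U) =
        (((1 : ℝ) : ℂ) * (1 : ℝ)) • 1 := by
    refine blkRefl_mul_self hx (D.commute_P12 _ (hc (Commute.refl B)).symm) hU' (hc hUB.neg_left)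
      (D.commute_P12 _ hUB.neg_left) D.isSelfAdjoint_P12 ?_
    rw [D.P12_mul_self, ← cc_sub_dd lam]
    simp only [mul_sub, sub_mul, mul_add, add_mul, mul_smul_comm, smul_mul_assoc,
      D.mul_ringInverse, D.ringInverse_mul, cc, dd]
    match_scalars <;> ring
  have := isOrthoProj_of_mul_self_eq (star_blkRefl hx D.isSelfAdjoint_P12 (-U)) one_ne_zero h
  rwa [Complex.ofReal_one, inv_one, one_smul, ← QU_eq D.isUnit] at this

lemma smul_PU_add_QU (D : PencilData lam B) (hl : lam ≠ 0) (U : K →L[ℂ] K) :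
    (lam : ℂ) • PU lam B U + QU lam B U = blk B 0 0 (-B) + cc lam • 1 := by
  have hl' : (lam : ℂ) ≠ 0 := by exact_mod_cast hl
  rw [PU_eq hl D.isUnit, QU_eq D.isUnit, ← blk_one]
  simp only [blkRefl, smul_blk, blk_add, blk_inj, star_neg, mul_neg, neg_mul, cc]
  refine ⟨?_, ?_, ?_, ?_⟩ <;> match_scalars <;> field_simp <;> ring

/-- Every solution on `K ⊕ K` is one of the pairs `(P_U, Q_U)`. -/
lemma exists_unitary_of_pencil (D : PencilData lam B) (hl : lam ≠ 0)
    {P Q : WithLp 2 (K × K) →L[ℂ] WithLp 2 (K × K)} (hP : IsOrthoProj P) (hQ : IsOrthoProj Q)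
    (hPQ : blk B 0 0 (-B) + cc lam • 1 = (lam : ℂ) • P + Q) :
    ∃ U ∈ unitary (K →L[ℂ] K), Commute U B ∧ P = PU lam B U ∧ Q = QU lam B U := by
  have hl' : (lam : ℂ) ≠ 0 := by exact_mod_cast hl
  set J : WithLp 2 (K × K) →L[ℂ] WithLp 2 (K × K) := (lam : ℂ) • ((2 : ℂ) • P - 1) with hJdef
  have hJstar : star J = J := hP.star_smul_two_smul_sub_one lam
  have hJJ : J * J = ((lam : ℂ) * lam) • 1 := by
    rw [hJdef, smul_mul_smul_comm, hP.two_smul_sub_one_mul_self]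
  have hPJ : P = (2⁻¹ : ℂ) • (1 + (lam : ℂ)⁻¹ • J) := by
    rw [hJdef]
    match_scalars <;> field_simp; ring
  have hLJ : (2 : ℂ) • Q - 1 = (2 : ℂ) • blk B 0 0 (-B) + (-1 : ℂ) • J := by
    rw [← sub_eq_iff_eq_add'.mpr hPQ, hJdef, cc]
    match_scalars <;> ring
  have hLL := hQ.two_smul_sub_one_mul_self
  rw [hLJ] at hLL
  obtain ⟨x, y, y', z, hJ⟩ := exists_eq_blk J
  rw [hJ] at hJstar hJJ hLL hPJ
  rw [star_blk, blk_inj] at hJstar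
  obtain ⟨-, -, rfl, -⟩ := hJstar
  rw [blk_mul, ← blk_one, smul_blk, blk_inj] at hJJ
  simp only [smul_blk, blk_add] at hLL
  rw [blk_mul, ← blk_one, blk_inj] at hLL
  obtain ⟨e₁₁, e₁₂, e₂₁, e₂₂⟩ := hJJ
  obtain ⟨f₁₁, f₁₂, f₂₁, f₂₂⟩ := hLL
  simp only [smul_zero, zero_add, mul_add, add_mul, mul_smul_comm, smul_mul_assoc, mul_neg,
    neg_mul, smul_neg, smul_smul, smul_add] at f₁₁ f₁₂ f₂₁ f₂₂
  have hk : (4 : ℂ) * (cc lam * dd lam) = 1 - lam * lam := by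
    simp only [cc, dd]; push_cast; ring
  have hBx : B * x + x * B = (2 : ℂ) • (B * B) - (2 * (cc lam * dd lam)) • 1 := by
    linear_combination (norm := module) (-2⁻¹ : ℂ) • f₁₁ + (2⁻¹ : ℂ) • e₁₁ +
      (2⁻¹ : ℂ) • hk • (1 : K →L[ℂ] K)
  have hBz : B * z + z * B = -((2 : ℂ) • (B * B) - (2 * (cc lam * dd lam)) • 1) := by
    linear_combination (norm := module) (2⁻¹ : ℂ) • f₂₂ - (2⁻¹ : ℂ) • e₂₂ -
      (2⁻¹ : ℂ) • hk • (1 : K →L[ℂ] K)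
  have hBy : Commute B y := by
    change B * y = y * B
    linear_combination (norm := module) (-2⁻¹ : ℂ) • f₁₂ + (2⁻¹ : ℂ) • e₁₂
  set a : K →L[ℂ] K := B - (cc lam * dd lam) • Ring.inverse B with ha
  have hBa : B * a + a * B = (2 : ℂ) • (B * B) - (2 * (cc lam * dd lam)) • 1 := by
    simp only [ha, mul_sub, sub_mul, mul_smul_comm, smul_mul_assoc, D.mul_ringInverse,
      D.ringInverse_mul]
    module
  have hxa : x = a := by
    refine sub_eq_zero.mp (eq_zero_of_anticommute D.nonneg D.isUnit ?_)
    rw [mul_sub, sub_mul, sub_add_sub_comm, hBx, hBa, sub_self]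
  have hza : z = -a := by
    refine eq_neg_of_add_eq_zero_left (eq_zero_of_anticommute D.nonneg D.isUnit ?_)
    rw [mul_add, add_mul, add_add_add_comm, hBz, hBa, neg_add_cancel]
  subst hxa hza
  have hyy : y * star y = P12 lam B * P12 lam B := by
    rw [D.P12_mul_self, ← e₁₁, add_sub_cancel_left]
  have hyy' : star y * y = P12 lam B * P12 lam B := by
    rw [D.P12_mul_self, ← e₂₂, neg_mul_neg, add_sub_cancel_right]
  obtain ⟨U, hU, hyU, hcomm⟩ := exists_unitary_of_star_mul_self_eq D.isSelfAdjoint_P12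
    D.injective_P12 (D.commute_P12 y hBy.symm).symm hyy' hyy
  have hUB := hcomm B (D.commute_P12 B (Commute.refl B)) hBy
  have hPU : P = PU lam B U := by
    rw [hPJ, PU_eq hl D.isUnit, blkRefl, hyU, star_mul, D.isSelfAdjoint_P12.star_eq]
  refine ⟨U, hU, hUB, hPU, ?_⟩
  have h := D.smul_PU_add_QU hl U
  rw [hPQ, hPU] at h
  exact (add_left_cancel h).symm

end PencilData

end Classification

/-- For `λ ∈ ℝ \ {−1, 0, 1}` and `T = 0 ⊕ I ⊕ λI ⊕ (1+λ)I ⊕ ((B ⊕ (−B)) + ((1+λ)/2)I)`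
(relative to `H = ker T ⊕ ker(T−I) ⊕ ker(T−λI) ⊕ ker(T−(1+λ)I) ⊕ (K ⊕ K)`) with
`(|1−|λ||/2)·I < B < ((1+|λ|)/2)·I`, the pairs of projections `(P, Q)` with `T = λP + Q`
are exactly the pairs `(0⊕0⊕I⊕I⊕P_U, 0⊕I⊕0⊕I⊕Q_U)` for unitaries `U` commuting with `B`;
in particular such a pair exists. -/
theorem pencil_pairs_full_classification
    {H₀ H₁ H₂ H₃ : Type*}
    [NormedAddCommGroup H₀] [InnerProductSpace ℂ H₀] [CompleteSpace H₀]
    [NormedAddCommGroup H₁] [InnerProductSpace ℂ H₁] [CompleteSpace H₁]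
    [NormedAddCommGroup H₂] [InnerProductSpace ℂ H₂] [CompleteSpace H₂]
    [NormedAddCommGroup H₃] [InnerProductSpace ℂ H₃] [CompleteSpace H₃]
    (lam : ℝ) (hlam : lam ≠ -1 ∧ lam ≠ 0 ∧ lam ≠ 1)
    (B : K →L[ℂ] K) (hBpos : B.IsPositive)
    (hB₁ : OpLt (((abs (1 - |lam|) / 2 : ℝ) : ℂ) • (1 : K →L[ℂ] K)) B)
    (hB₂ : OpLt B ((((1 + |lam|) / 2 : ℝ) : ℂ) • (1 : K →L[ℂ] K)))
    (T : WithLp 2 (H₀ × WithLp 2 (H₁ × WithLp 2 (H₂ × WithLp 2 (H₃ × WithLp 2 (K × K))))) →L[ℂ]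
         WithLp 2 (H₀ × WithLp 2 (H₁ × WithLp 2 (H₂ × WithLp 2 (H₃ × WithLp 2 (K × K))))))
    (hT : T = dsum 0 (dsum 1 (dsum ((lam : ℂ) • 1)
      (dsum (((1 + lam : ℝ) : ℂ) • 1) (blk B 0 0 (-B) + cc lam • 1))))) :
    (∀ P Q, (IsOrthoProj P ∧ IsOrthoProj Q ∧ T = (lam : ℂ) • P + Q) ↔
      (∃ U ∈ unitary (K →L[ℂ] K), Commute U B ∧
        P = dsum 0 (dsum 0 (dsum 1 (dsum 1 (PU lam B U)))) ∧
        Q = dsum 0 (dsum 1 (dsum 0 (dsum 1 (QU lam B U)))))) ∧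
    (∃ P Q, IsOrthoProj P ∧ IsOrthoProj Q ∧ T = (lam : ℂ) • P + Q) := by
  obtain ⟨hl₁, hl₀, hl₂⟩ := hlam
  have D := pencilData ⟨hl₁, hl₀, hl₂⟩ hBpos hB₁ hB₂
  have hadd : lam + 1 ≠ 0 := fun h => hl₁ (by linarith)
  have hsub : lam - 1 ≠ 0 := fun h => hl₂ (by linarith)
  have hiff : ∀ P Q, (IsOrthoProj P ∧ IsOrthoProj Q ∧ T = (lam : ℂ) • P + Q) ↔
      (∃ U ∈ unitary (K →L[ℂ] K), Commute U B ∧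
        P = dsum 0 (dsum 0 (dsum 1 (dsum 1 (PU lam B U)))) ∧
        Q = dsum 0 (dsum 1 (dsum 0 (dsum 1 (QU lam B U))))) := by
    intro P Q
    subst hT
    rw [pencil_dsum_iff (P₀ := 0) (Q₀ := 0) 0 0 (by norm_num) (by norm_num) hl₀
      (by convert hadd using 1; ring) (by simp) (by simp) (by simp)]
    simp only [pencil_dsum_iff (E := H₁) (P₀ := 0) (Q₀ := 1) 0 1 (by norm_num) (by norm_num) hl₀
        (by convert hsub using 1; ring) (A := 1) (by simp) (by simp) (by simp),
      pencil_dsum_iff (E := H₂) (P₀ := 1) (Q₀ := 0) 1 0 (by norm_num) (by norm_num) hl₀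
        (by convert hsub using 1; ring) (A := (lam : ℂ) • 1) (by simp) (by simp) (by simp),
      pencil_dsum_iff (E := H₃) (P₀ := 1) (Q₀ := 1) 1 1 (by norm_num) (by norm_num) hl₀
        (by convert hadd using 1; ring) (A := ((1 + lam : ℝ) : ℂ) • 1)
        (by simp [add_comm]) (by simp) (by simp)]
    constructor
    · rintro ⟨_, _, rfl, rfl, _, _, rfl, rfl, _, _, rfl, rfl, _, _, rfl, rfl, hP, hQ, h⟩
      obtain ⟨U, hU, hUB, rfl, rfl⟩ := D.exists_unitary_of_pencil hl₀ hP hQ h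
      exact ⟨U, hU, hUB, rfl, rfl⟩
    · rintro ⟨U, hU, hUB, rfl, rfl⟩
      exact ⟨_, _, rfl, rfl, _, _, rfl, rfl, _, _, rfl, rfl, _, _, rfl, rfl,
        D.isOrthoProj_PU hl₀ hU hUB, D.isOrthoProj_QU hU hUB, (D.smul_PU_add_QU hl₀ U).symm⟩
  exact ⟨hiff, _, _, (hiff _ _).mpr ⟨1, one_mem _, Commute.one_left B, rfl, rfl⟩⟩
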